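/- arXiv:math/0603110 — 2 statements merged into one kernel-verified Lean document; each statement's English description precedes it below -/
import Mathlib

section
/- Let X be a Γ-set and let G be the free group on X, regarded as a Γ-group via the action determined on generators by σ•⟨x⟩ = ⟨σ•x⟩. Then the Γ-abelianization G/[G,G]_Γ is a free abelian group with basis the image of X; precisely, there is an isomorphism of abelian groups G/[G,G]_Γ ≅ ℤ[X/Γ] (the free abelian group on the set of Γ-orbits of X) sending the class of the generator ⟨x⟩ to the basis element indexed by the orbit of x. -/
/-- The Γ-commutator subgroup `[G,G]_Γ` of a Γ-group `G`: the subgroup generated by all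
commutators together with the elements `(σ • g) * g⁻¹`. -/
def gammaCommutator (Γ G : Type*) [Group Γ] [Group G] [MulDistribMulAction Γ G] : Subgroup G :=
  Subgroup.closure ({x | ∃ a b : G, x = a * b * a⁻¹ * b⁻¹} ∪
    {x | ∃ (σ : Γ) (g : G), x = σ • g * g⁻¹})

instance gammaCommutator_normal (Γ G : Type*) [Group Γ] [Group G] [MulDistribMulAction Γ G] :
    (gammaCommutator Γ G).Normal := by
  constructor
  intro n hn g
  have h1 : g * n * g⁻¹ * n⁻¹ ∈ gammaCommutator Γ G :=
    Subgroup.subset_closure (Or.inl ⟨g, n, rfl⟩)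
  have h2 := mul_mem h1 hn
  simpa [mul_assoc] using h2

/-- The action of `Γ` on the free group on a Γ-set `X`, determined on generators by
`σ • ⟨x⟩ = ⟨σ • x⟩`. -/
instance freeGroupGammaAction (Γ X : Type*) [Group Γ] [MulAction Γ X] :
    MulDistribMulAction Γ (FreeGroup X) where
  smul σ w := FreeGroup.map (σ • ·) w
  one_smul w := by
    show FreeGroup.map _ w = w
    rw [show ((fun x : X => (1 : Γ) • x)) = id from funext fun x => one_smul Γ x]
    exact FreeGroup.map.id w
  mul_smul σ τ w := by
    show FreeGroup.map _ w = FreeGroup.map _ (FreeGroup.map _ w)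
    rw [FreeGroup.map.comp]
    have h : ((fun x : X => σ • x) ∘ fun x : X => τ • x) = fun x : X => (σ * τ) • x :=
      funext fun x => (mul_smul σ τ x).symm
    rw [h]
  smul_mul σ x y := map_mul (FreeGroup.map (σ • ·)) x y
  smul_one σ := map_one (FreeGroup.map (σ • ·))

section GammaAbelianization

variable (Γ G : Type*) [Group Γ] [Group G] [MulDistribMulAction Γ G]

/-- The Γ-abelianization is commutative. -/
instance gammaAbelianization_commGroup : CommGroup (G ⧸ gammaCommutator Γ G) where
  mul_comm a b := by
    induction a using QuotientGroup.induction_on with | _ a =>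
    induction b using QuotientGroup.induction_on with | _ b =>
    rw [← QuotientGroup.mk_mul, ← QuotientGroup.mk_mul]
    exact QuotientGroup.eq.2 (Subgroup.subset_closure (Or.inl ⟨b⁻¹, a⁻¹, by group⟩))

variable {Γ G}

/-- `Γ` acts trivially on the Γ-abelianization. -/
theorem mk_smul_gammaCommutator (σ : Γ) (g : G) :
    (QuotientGroup.mk (σ • g) : G ⧸ gammaCommutator Γ G) = QuotientGroup.mk g := by
  rw [← div_eq_one, div_eq_mul_inv, ← QuotientGroup.mk_inv, ← QuotientGroup.mk_mul,
    QuotientGroup.eq_one_iff]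
  exact Subgroup.subset_closure (Or.inr ⟨σ, g, rfl⟩)

/-- A Γ-invariant homomorphism to a commutative group kills the Γ-commutator subgroup. -/
theorem gammaCommutator_le_ker {A : Type*} [CommGroup A] (f : G →* A)
    (hf : ∀ (σ : Γ) (g : G), f (σ • g) = f g) : gammaCommutator Γ G ≤ f.ker := by
  refine (Subgroup.closure_le _).2 ?_
  rintro _ (⟨a, b, rfl⟩ | ⟨σ, g, rfl⟩)
  · simp [MonoidHom.mem_ker]
  · simp [MonoidHom.mem_ker, hf]

end GammaAbelianization

section FreeGroup

variable (Γ X : Type*) [Group Γ] [MulAction Γ X]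

variable {Γ X} in
theorem smul_freeGroup_eq_map (σ : Γ) (w : FreeGroup X) : σ • w = FreeGroup.map (σ • ·) w :=
  rfl

/-- The homomorphism `F(X) → ℤ[X/Γ]` sending a generator to its orbit. -/
noncomputable def freeGroupToOrbits :
    FreeGroup X →* Multiplicative (Quotient (MulAction.orbitRel Γ X) →₀ ℤ) :=
  FreeGroup.lift fun x =>
    Multiplicative.ofAdd (Finsupp.single (Quotient.mk (MulAction.orbitRel Γ X) x) 1)

variable {X} in
@[simp]
theorem freeGroupToOrbits_of (x : X) :
    freeGroupToOrbits Γ X (FreeGroup.of x) =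
      Multiplicative.ofAdd (Finsupp.single (Quotient.mk (MulAction.orbitRel Γ X) x) 1) :=
  FreeGroup.lift_apply_of

variable {Γ X} in
theorem freeGroupToOrbits_smul (σ : Γ) (w : FreeGroup X) :
    freeGroupToOrbits Γ X (σ • w) = freeGroupToOrbits Γ X w := by
  have h : (freeGroupToOrbits Γ X).comp (FreeGroup.map (σ • ·)) = freeGroupToOrbits Γ X := by
    ext1 x
    have hx : Quotient.mk (MulAction.orbitRel Γ X) (σ • x) = Quotient.mk _ x :=
      Quotient.sound (MulAction.mem_orbit x σ)
    simp [hx]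
  exact DFunLike.congr_fun h w

/-- The class of a generator in the Γ-abelianization, as a function of its orbit. -/
def orbitClass (q : Quotient (MulAction.orbitRel Γ X)) :
    FreeGroup X ⧸ gammaCommutator Γ (FreeGroup X) :=
  Quotient.lift (fun x => QuotientGroup.mk (FreeGroup.of x)) (by
    rintro _ x ⟨σ, rfl⟩
    simpa [smul_freeGroup_eq_map] using mk_smul_gammaCommutator σ (FreeGroup.of x)) q

/-- The homomorphism `ℤ[X/Γ] → F(X)/[F(X),F(X)]_Γ` sending an orbit to the class of the
corresponding generators. -/
noncomputable def orbitsToGammaAbelianization :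
    Multiplicative (Quotient (MulAction.orbitRel Γ X) →₀ ℤ) →*
      FreeGroup X ⧸ gammaCommutator Γ (FreeGroup X) :=
  AddMonoidHom.toMultiplicativeLeft (Finsupp.liftAddHom fun q =>
    zmultiplesHom _ (Additive.ofMul (orbitClass Γ X q)))

variable {X} in
@[simp]
theorem orbitsToGammaAbelianization_single (x : X) :
    orbitsToGammaAbelianization Γ X
        (Multiplicative.ofAdd (Finsupp.single (Quotient.mk (MulAction.orbitRel Γ X) x) 1)) =
      QuotientGroup.mk (FreeGroup.of x) := by
  simp [orbitsToGammaAbelianization, orbitClass]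

end FreeGroup

/-- Let `X` be a Γ-set and `G = F(X)` the free group on `X` with the induced
Γ-action.  Then the Γ-abelianization `G/[G,G]_Γ` is free abelian on the set of Γ-orbits of
`X`: there is an isomorphism with the free abelian group `ℤ[X/Γ]` sending the class of the
generator `⟨x⟩` to the basis element indexed by the orbit of `x`. -/
theorem gammaAbelianization_of_freeGroup_free (Γ X : Type*) [Group Γ] [MulAction Γ X] :
    ∃ e : (FreeGroup X ⧸ gammaCommutator Γ (FreeGroup X)) ≃*
        Multiplicative (Quotient (MulAction.orbitRel Γ X) →₀ ℤ),
      ∀ x : X, e (QuotientGroup.mk (FreeGroup.of x)) =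
        Multiplicative.ofAdd (Finsupp.single (Quotient.mk (MulAction.orbitRel Γ X) x) 1) := by
  refine ⟨MonoidHom.toMulEquiv
    (QuotientGroup.lift _ (freeGroupToOrbits Γ X)
      (gammaCommutator_le_ker _ freeGroupToOrbits_smul))
    (orbitsToGammaAbelianization Γ X) ?_ ?_, freeGroupToOrbits_of Γ⟩
  · ext x
    simp
  · refine MonoidHom.toAdditive.injective (Finsupp.addHom_ext' fun q => ?_)
    induction q using Quotient.inductionOn with | _ x =>
    refine AddMonoidHom.ext_int ?_
    exact (congrArg _ (orbitsToGammaAbelianization_single Γ x)).trans (freeGroupToOrbits_of Γ x)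
end

section
/- Let G be a Γ-group which is a retract of a free group on a Γ-set, i.e. there exist a Γ-set X and Γ-homomorphisms i: G → F(X), r: F(X) → G with r∘i = id_G, where F(X) is the free group on X with Γ-action determined by σ•⟨x⟩ = ⟨σ•x⟩. Let A be a G⋊Γ-module, and consider the cochain complex whose n-th term C^n_Γ(G,A) is the abelian group of Γ-equivariant functions f: Gⁿ → A (Γ acting diagonally on Gⁿ), with the standard inhomogeneous group-cohomology differential δⁿ(f)(g₁,…,g_{n+1}) = g₁•f(g₂,…,g_{n+1}) + Σ_{i=1}^{n} (−1)ⁱ f(g₁,…,g_i g_{i+1},…,g_{n+1}) + (−1)^{n+1} f(g₁,…,g_n). Then this complex is exact in all degrees n > 1: ker δⁿ = im δ^{n−1} for every n > 1. -/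
variable {Γ G A : Type*} [Group Γ] [Group G] [MulDistribMulAction Γ G] [AddCommGroup A]
  [DistribMulAction G A] [DistribMulAction Γ A]

/-- The standard inhomogeneous group-cohomology coboundary operator on `n`-cochains
`f : Gⁿ → A`. -/
def cobound (n : ℕ) (f : (Fin n → G) → A) : (Fin (n + 1) → G) → A := fun g =>
  g 0 • f (Fin.tail g) +
    (∑ i ∈ Finset.range n, ((-1 : ℤ) ^ (i + 1)) •
      f (fun j => if (j : ℕ) < i then g j.castSucc
        else if (j : ℕ) = i then g j.castSucc * g j.succ else g j.succ)) +
    ((-1 : ℤ) ^ (n + 1)) • f (Fin.init g)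

universe u v w x

section Cobound

variable {Γ G A M : Type*} [Group Γ] [Group G] [MulDistribMulAction Γ G] [AddCommGroup A]
  [DistribMulAction G A] [DistribMulAction Γ A] [AddCommGroup M] [DistribMulAction G M]

/-- The tuple obtained from `g` by multiplying the entries of index `i` and `i + 1`. -/
def contractTuple {n : ℕ} (i : ℕ) (g : Fin (n + 1) → G) : Fin n → G := fun j =>
  if (j : ℕ) < i then g j.castSucc
  else if (j : ℕ) = i then g j.castSucc * g j.succ else g j.succ

theorem cobound_apply (n : ℕ) (f : (Fin n → G) → A) (g : Fin (n + 1) → G) :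
    cobound n f g = g 0 • f (Fin.tail g) +
      (∑ i ∈ Finset.range n, ((-1 : ℤ) ^ (i + 1)) • f (contractTuple i g)) +
      ((-1 : ℤ) ^ (n + 1)) • f (Fin.init g) := rfl

theorem contractTuple_zero_zero {n : ℕ} (g : Fin (n + 2) → G) :
    contractTuple 0 g 0 = g 0 * g 1 := by
  simp [contractTuple]

theorem tail_contractTuple_zero {n : ℕ} (g : Fin (n + 2) → G) :
    Fin.tail (contractTuple 0 g) = Fin.tail (Fin.tail g) := by
  funext j
  simp [contractTuple, Fin.tail]

theorem contractTuple_succ_zero {n : ℕ} (i : ℕ) (g : Fin (n + 2) → G) :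
    contractTuple (i + 1) g 0 = g 0 := by
  simp [contractTuple]

theorem tail_contractTuple_succ {n : ℕ} (i : ℕ) (g : Fin (n + 2) → G) :
    Fin.tail (contractTuple (i + 1) g) = contractTuple i (Fin.tail g) := by
  funext j
  simp [contractTuple, Fin.tail]

theorem smul_contractTuple {n : ℕ} (σ : Γ) (i : ℕ) (g : Fin (n + 1) → G) :
    contractTuple i (fun j => σ • g j) = fun j => σ • contractTuple i g j := by
  funext j
  simp only [contractTuple]
  split_ifs <;> simp [smul_mul']

theorem cobound_add (n : ℕ) (f f' : (Fin n → G) → A) :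
    cobound n (f + f') = cobound n f + cobound n f' := by
  funext g
  simp only [cobound_apply, Pi.add_apply, smul_add, Finset.sum_add_distrib]
  abel

theorem cobound_neg (n : ℕ) (f : (Fin n → G) → A) : cobound n (-f) = -cobound n f :=
  (AddMonoidHom.mk' (cobound (G := G) (A := A) n) (cobound_add n)).map_neg f

theorem cobound_sub (n : ℕ) (f f' : (Fin n → G) → A) :
    cobound n (f - f') = cobound n f - cobound n f' :=
  (AddMonoidHom.mk' (cobound (G := G) (A := A) n) (cobound_add n)).map_sub f f'

theorem cobound_equivariant
    (hcompat : ∀ (σ : Γ) (g : G) (a : A), σ • (g • a) = (σ • g) • (σ • a)) {n : ℕ}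
    {f : (Fin n → G) → A} (hf : ∀ (σ : Γ) (g : Fin n → G), f (fun j => σ • g j) = σ • f g)
    (σ : Γ) (g : Fin (n + 1) → G) :
    cobound n f (fun j => σ • g j) = σ • cobound n f g := by
  have h1 : Fin.tail (fun j => σ • g j) = fun j => σ • Fin.tail g j := rfl
  have h2 : Fin.init (fun j => σ • g j) = fun j => σ • Fin.init g j := rfl
  simp only [cobound_apply, smul_contractTuple, h1, h2, hf, smul_add, Finset.smul_sum, hcompat,
    smul_comm σ (_ : ℤ)]

theorem cobound_map (φ : A →+ M) (hφ : ∀ (g : G) (a : A), φ (g • a) = g • φ a) (n : ℕ)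
    (f : (Fin n → G) → A) : cobound n (fun g => φ (f g)) = fun g => φ (cobound n f g) := by
  funext g
  simp only [cobound_apply, map_add, map_sum, map_zsmul, hφ]

/-- The `(n+1)`-cochain with values in `A` attached to an `n`-cochain `η` whose values are, via
`ev`, functions from `G` to `A`. -/
def shiftCochain (ev : M →+ (G → A)) {n : ℕ} (η : (Fin n → G) → M) :
    (Fin (n + 1) → G) → A := fun g => g 0 • ev (η (Fin.tail g)) (g 0)⁻¹

theorem cobound_shiftCochain (ev : M →+ (G → A)) {n : ℕ} (η : (Fin n → G) → M)
    (g : Fin (n + 2) → G) :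
    cobound (n + 1) (shiftCochain ev η) g = -shiftCochain ev (cobound n η) g +
      (g 0 • g 1 • ev (η (Fin.tail (Fin.tail g))) (g 1)⁻¹
        - (g 0 * g 1) • ev (η (Fin.tail (Fin.tail g))) (g 0 * g 1)⁻¹
        + g 0 • ev (g 1 • η (Fin.tail (Fin.tail g))) (g 0)⁻¹) := by
  have h1 : Fin.tail g 0 = g 1 := rfl
  have h2 : Fin.init g 0 = g 0 := rfl
  simp only [cobound_apply, shiftCochain, Finset.sum_range_succ', contractTuple_zero_zero,
    tail_contractTuple_zero, contractTuple_succ_zero, tail_contractTuple_succ, h1, h2,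
    Fin.tail_init_eq_init_tail, map_add, map_sum, map_zsmul, Pi.add_apply, Finset.sum_apply,
    Pi.smul_apply, smul_add, Finset.smul_sum, smul_comm (g 0) (_ : ℤ), pow_succ _ (_ + 1),
    mul_neg_one, neg_smul, Finset.sum_neg_distrib, zero_add, pow_one, one_smul]
  abel

end Cobound

/-- The coinduced module of all functions from `G` to `A`. -/
def CoindFun (G : Type u) (A : Type v) : Type (max u v) := G → A

namespace CoindFun

variable {G : Type u} {A : Type v} [Group G] [AddCommGroup A] [DistribMulAction G A]

instance : AddCommGroup (CoindFun G A) := inferInstanceAs (AddCommGroup (G → A))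

instance : DistribMulAction G (CoindFun G A) where
  smul g φ := fun k => g • φ (g⁻¹ * k)
  one_smul φ := funext fun k => show (1 : G) • φ (1⁻¹ * k) = φ k by simp
  mul_smul g h φ := funext fun k =>
    show (g * h) • φ ((g * h)⁻¹ * k) = g • h • φ (h⁻¹ * (g⁻¹ * k)) by
      simp [mul_smul, mul_assoc]
  smul_zero g := funext fun _ => smul_zero g
  smul_add g _ _ := funext fun _ => smul_add g _ _

/-- Evaluation of elements of the coinduced module. -/
def ev : CoindFun G A →+ (G → A) := AddMonoidHom.id (G → A)

theorem ev_smul (g : G) (φ : CoindFun G A) (k : G) : ev (g • φ) k = g • ev φ (g⁻¹ * k) := rfl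

/-- The embedding of `A` into the coinduced module by constant functions. -/
def const : A →+ CoindFun G A := Pi.constAddMonoidHom G A

theorem ev_const {G : Type u} {A : Type v} [AddCommGroup A] (a : A) (k : G) : ev (const a : CoindFun G A) k = a := rfl

theorem const_smul (g : G) (a : A) : const (g • a) = g • (const a : CoindFun G A) := rfl

theorem exists_shiftCochain {n : ℕ} (f : (Fin (n + 1) → G) → A) :
    ∃ η : (Fin n → G) → CoindFun G A, shiftCochain ev η = f := by
  refine ⟨fun g k => k • f (Fin.cons k⁻¹ g), funext fun g => ?_⟩
  change g 0 • (g 0)⁻¹ • f (Fin.cons (g 0)⁻¹⁻¹ (Fin.tail g)) = f g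
  rw [smul_inv_smul, inv_inv, Fin.cons_self_tail]

theorem cobound_shiftCochain_ev {n : ℕ} (η : (Fin n → G) → CoindFun G A) (g : Fin (n + 2) → G) :
    cobound (n + 1) (shiftCochain ev η) g =
      g 0 • shiftCochain ev η (Fin.tail g) - shiftCochain ev (cobound n η) g := by
  have h : Fin.tail g 0 = g 1 := rfl
  rw [cobound_shiftCochain, ev_smul, mul_inv_rev, mul_smul]
  simp only [shiftCochain, h]
  abel

end CoindFun

theorem cobound_cobound_of_coindFun {G : Type u} {A : Type v} [Group G] [AddCommGroup A]
    [DistribMulAction G A] {n : ℕ}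
    (ih : ∀ f : (Fin n → G) → CoindFun G A, cobound (n + 1) (cobound n f) = 0)
    (f : (Fin (n + 1) → G) → A) : cobound (n + 2) (cobound (n + 1) f) = 0 := by
  obtain ⟨η, rfl⟩ := CoindFun.exists_shiftCochain f
  set f := shiftCochain CoindFun.ev η with hf
  obtain ⟨ζ, hζ⟩ := CoindFun.exists_shiftCochain (cobound (n + 1) f)
  have key : ζ = (fun g => CoindFun.const (f g)) - cobound n η := by
    funext g
    refine funext fun k => ?_
    have h := congrFun hζ (Fin.cons k⁻¹ g)
    rw [hf, CoindFun.cobound_shiftCochain_ev, ← hf] at h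
    simp only [shiftCochain, Fin.cons_zero, Fin.tail_cons, inv_inv, ← smul_sub] at h
    exact smul_left_cancel _ h
  funext g
  rw [← hζ, CoindFun.cobound_shiftCochain_ev, hζ, key, cobound_sub, ih,
    cobound_map _ CoindFun.const_smul]
  simp [shiftCochain, CoindFun.ev_const]

theorem cobound_cobound_aux {G : Type u} [Group G] (n : ℕ) :
    ∀ {A : Type (max u v)} [AddCommGroup A] [DistribMulAction G A] (f : (Fin n → G) → A),
      cobound (n + 1) (cobound n f) = 0 := by
  induction n with
  | zero =>
    intro A _ _ f
    funext g
    have h : Fin.tail g 0 = g 1 := rfl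
    have h' : Fin.init g 0 = g 0 := rfl
    simp only [cobound_apply, Subsingleton.elim _ (default : Fin 0 → G), zero_add,
      Finset.sum_range_one, Finset.range_zero, Finset.sum_empty, contractTuple_zero_zero, h, h',
      mul_smul, smul_add, pow_one, neg_smul, one_smul, smul_neg, add_zero, even_two.neg_pow,
      one_pow, Pi.zero_apply, one_add_one_eq_two]
    abel
  | succ n ih =>
    intro A _ _ f
    exact cobound_cobound_of_coindFun (fun f => ih f) f

theorem cobound_cobound_succ {G : Type u} {A : Type v} [Group G] [AddCommGroup A]
    [DistribMulAction G A] (n : ℕ) (f : (Fin (n + 1) → G) → A) :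
    cobound (n + 2) (cobound (n + 1) f) = 0 :=
  cobound_cobound_of_coindFun (fun f => cobound_cobound_aux.{u, v} n f) f

/-- The dimension-shifting module: functions from `G` to `A` vanishing at `1`, identified with
the quotient of the coinduced module by the constant functions. -/
def NormalizedFun (G : Type u) (A : Type v) [Group G] [AddCommGroup A] : Type (max u v) :=
  (Pi.evalAddMonoidHom (fun _ : G => A) 1).ker

namespace NormalizedFun

section

variable {G : Type u} {A : Type v} [Group G] [AddCommGroup A]

instance : AddCommGroup (NormalizedFun G A) :=
  inferInstanceAs (AddCommGroup (Pi.evalAddMonoidHom (fun _ : G => A) 1).ker)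

/-- Evaluation of normalized functions. -/
def ev : NormalizedFun G A →+ (G → A) := (Pi.evalAddMonoidHom (fun _ : G => A) 1).ker.subtype

theorem ev_one (φ : NormalizedFun G A) : ev φ 1 = 0 := φ.2

@[ext]
theorem ext {φ ψ : NormalizedFun G A} (h : ∀ k, ev φ k = ev ψ k) : φ = ψ :=
  Subtype.ext (funext h)

variable {Γ : Type w} [Group Γ] [MulDistribMulAction Γ G] [DistribMulAction Γ A]

instance : SMul Γ (NormalizedFun G A) where
  smul σ φ := ⟨fun k => σ • ev φ (σ⁻¹ • k), by simp [AddMonoidHom.mem_ker, ev_one]⟩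

theorem ev_smul' (σ : Γ) (φ : NormalizedFun G A) (k : G) :
    ev (σ • φ) k = σ • ev φ (σ⁻¹ • k) := rfl

end

variable {Γ : Type w} {G : Type u} {A : Type v} [Group Γ] [Group G] [MulDistribMulAction Γ G]
  [AddCommGroup A] [DistribMulAction G A] [DistribMulAction Γ A]

instance : SMul G (NormalizedFun G A) where
  smul g φ := ⟨fun k => g • ev φ (g⁻¹ * k) - g • ev φ g⁻¹, by simp [AddMonoidHom.mem_ker]⟩

theorem ev_smul (g : G) (φ : NormalizedFun G A) (k : G) :
    ev (g • φ) k = g • ev φ (g⁻¹ * k) - g • ev φ g⁻¹ := rfl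

instance : DistribMulAction G (NormalizedFun G A) where
  one_smul φ := by ext k; simp [ev_smul, ev_one]
  mul_smul g h φ := by ext k; simp [ev_smul, mul_smul, mul_assoc, smul_sub]
  smul_zero g := by ext k; simp [ev_smul]
  smul_add g φ ψ := by
    ext k
    simp only [ev_smul, map_add, Pi.add_apply, smul_add]
    abel

instance : DistribMulAction Γ (NormalizedFun G A) where
  one_smul φ := by ext k; simp [ev_smul']
  mul_smul σ τ φ := by ext k; simp [ev_smul', mul_smul]
  smul_zero σ := by ext k; simp [ev_smul']
  smul_add σ φ ψ := by ext k; simp [ev_smul']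

theorem smul_smul_compat
    (hcompat : ∀ (σ : Γ) (g : G) (a : A), σ • (g • a) = (σ • g) • (σ • a))
    (σ : Γ) (g : G) (φ : NormalizedFun G A) : σ • (g • φ) = (σ • g) • (σ • φ) := by
  ext k
  simp [ev_smul, ev_smul', smul_sub, hcompat, smul_mul']

theorem exists_shiftCochain {n : ℕ} (f : (Fin (n + 1) → G) → A)
    (hf : ∀ g, f (Fin.cons 1 g) = 0) :
    ∃ η : (Fin n → G) → NormalizedFun G A, shiftCochain ev η = f := by
  refine ⟨fun g => ⟨fun k => k • f (Fin.cons k⁻¹ g), ?_⟩, funext fun g => ?_⟩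
  · simp [AddMonoidHom.mem_ker, hf]
  · change g 0 • (g 0)⁻¹ • f (Fin.cons (g 0)⁻¹⁻¹ (Fin.tail g)) = f g
    rw [smul_inv_smul, inv_inv, Fin.cons_self_tail]

theorem ev_eq_smul_shiftCochain {n : ℕ} (η : (Fin n → G) → NormalizedFun G A) (g : Fin n → G)
    (k : G) : ev (η g) k = k • shiftCochain ev η (Fin.cons k⁻¹ g) := by
  simp [shiftCochain]

theorem cobound_shiftCochain_ev {n : ℕ} (η : (Fin n → G) → NormalizedFun G A) :
    cobound (n + 1) (shiftCochain ev η) = -shiftCochain ev (cobound n η) := by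
  funext g
  rw [cobound_shiftCochain, ev_smul, mul_inv_rev, mul_smul, smul_sub, Pi.neg_apply]
  abel

theorem shiftCochain_equivariant_iff
    (hcompat : ∀ (σ : Γ) (g : G) (a : A), σ • (g • a) = (σ • g) • (σ • a)) {n : ℕ}
    (η : (Fin n → G) → NormalizedFun G A) :
    (∀ (σ : Γ) (g : Fin (n + 1) → G),
      shiftCochain ev η (fun j => σ • g j) = σ • shiftCochain ev η g) ↔
    ∀ (σ : Γ) (g : Fin n → G), η (fun j => σ • g j) = σ • η g := by
  constructor
  · intro h σ g
    ext k
    have hc : (Fin.cons k⁻¹ (fun j => σ • g j) : Fin (n + 1) → G) =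
        fun j => σ • (Fin.cons (σ⁻¹ • k)⁻¹ g : Fin (n + 1) → G) j := by
      funext j
      cases j using Fin.cases <;> simp
    rw [ev_smul', ev_eq_smul_shiftCochain, ev_eq_smul_shiftCochain, hc, h, hcompat, smul_inv_smul]
  · intro h σ g
    have ht : Fin.tail (fun j => σ • g j) = fun j => σ • Fin.tail g j := rfl
    simp [shiftCochain, ht, h, ev_smul', hcompat]

end NormalizedFun

section DimensionShift

variable {Γ : Type w} {G : Type u} {A : Type v} [Group Γ] [Group G] [MulDistribMulAction Γ G]
  [AddCommGroup A] [DistribMulAction G A] [DistribMulAction Γ A]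

theorem cobound_cons_one {n : ℕ} {f : (Fin (n + 1) → G) → A} (hf : cobound (n + 1) f = 0)
    (g : Fin (n + 1) → G) :
    cobound n (fun g' => f (Fin.cons 1 g')) g = g 0 • f (Fin.cons 1 (Fin.tail g)) := by
  have h0 : contractTuple 0 (Fin.cons 1 g : Fin (n + 2) → G) = g := by
    funext j
    cases j using Fin.cases <;> simp [contractTuple]
  have h1 (i : ℕ) : contractTuple (i + 1) (Fin.cons 1 g : Fin (n + 2) → G) =
      Fin.cons 1 (contractTuple i g) := by
    rw [← Fin.cons_self_tail (contractTuple (i + 1) _), contractTuple_succ_zero,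
      tail_contractTuple_succ, Fin.cons_zero, Fin.tail_cons]
  have h2 : Fin.init (Fin.cons 1 g : Fin (n + 2) → G) = Fin.cons 1 (Fin.init g) := by
    funext j
    cases j using Fin.cases <;> simp [Fin.init]
  have h := congrFun hf (Fin.cons 1 g)
  simp only [cobound_apply, Finset.sum_range_succ', h0, h1, h2, Fin.cons_zero, Fin.tail_cons,
    one_smul, pow_succ _ (_ + 1), mul_neg_one, neg_smul, Finset.sum_neg_distrib, zero_add,
    pow_one, Pi.zero_apply] at h
  rw [cobound_apply, ← sub_eq_zero, ← neg_eq_zero, ← h]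
  abel

theorem exists_cobound_eq_of_normalizedFun
    (hcompat : ∀ (σ : Γ) (g : G) (a : A), σ • (g • a) = (σ • g) • (σ • a)) {n : ℕ}
    (ih : ∀ f : (Fin (n + 1) → G) → NormalizedFun G A,
      (∀ (σ : Γ) (g : Fin (n + 1) → G), f (fun j => σ • g j) = σ • f g) →
      cobound (n + 1) f = 0 → ∃ h : (Fin n → G) → NormalizedFun G A,
        (∀ (σ : Γ) (g : Fin n → G), h (fun j => σ • g j) = σ • h g) ∧ cobound n h = f)
    (f : (Fin (n + 2) → G) → A)
    (hequiv : ∀ (σ : Γ) (g : Fin (n + 2) → G), f (fun j => σ • g j) = σ • f g)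
    (hf : cobound (n + 2) f = 0) :
    ∃ h : (Fin (n + 1) → G) → A,
      (∀ (σ : Γ) (g : Fin (n + 1) → G), h (fun j => σ • g j) = σ • h g) ∧
        cobound (n + 1) h = f := by
  set f₁ : (Fin (n + 1) → G) → A := fun g => f (Fin.cons 1 g) with hf₁
  have hequiv₁ (σ : Γ) (g : Fin (n + 1) → G) : f₁ (fun j => σ • g j) = σ • f₁ g := by
    rw [hf₁]
    dsimp only
    rw [← hequiv]
    congr 1
    funext j
    cases j using Fin.cases <;> simp
  obtain ⟨η, hη⟩ := NormalizedFun.exists_shiftCochain (f - cobound (n + 1) f₁) fun g => by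
    rw [Pi.sub_apply, cobound_cons_one hf, Fin.cons_zero, one_smul, Fin.tail_cons, sub_self]
  have hη_equiv : ∀ (σ : Γ) (g : Fin (n + 1) → G), η (fun j => σ • g j) = σ • η g := by
    rw [← NormalizedFun.shiftCochain_equivariant_iff hcompat, hη]
    intro σ g
    simp only [Pi.sub_apply, hequiv, cobound_equivariant hcompat hequiv₁, smul_sub]
  have hη_cocycle : cobound (n + 1) η = 0 := by
    have h := NormalizedFun.cobound_shiftCochain_ev η
    rw [hη, cobound_sub, hf, cobound_cobound_succ, sub_zero, eq_comm, neg_eq_zero] at h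
    funext g
    ext k
    rw [NormalizedFun.ev_eq_smul_shiftCochain, h]
    simp
  obtain ⟨ζ, hζ_equiv, hζ⟩ := ih η hη_equiv hη_cocycle
  refine ⟨f₁ - shiftCochain NormalizedFun.ev ζ, fun σ g => ?_, ?_⟩
  · rw [Pi.sub_apply, Pi.sub_apply, hequiv₁,
      (NormalizedFun.shiftCochain_equivariant_iff hcompat ζ).2 hζ_equiv, smul_sub]
  · rw [cobound_sub, NormalizedFun.cobound_shiftCochain_ev, hζ, hη]
    abel

end DimensionShift

/-- The underlying set `A × G` of the group extension defined by a `2`-cocycle `c`. -/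
@[ext]
structure CocycleExtension {G : Type u} {A : Type v} (c : G → G → A) where
  /-- The component in the kernel. -/
  left : A
  /-- The component in the quotient. -/
  right : G

namespace CocycleExtension

variable {G : Type u} {A : Type v} [Group G] [AddCommGroup A] [DistribMulAction G A]
  {c : G → G → A}

instance : Mul (CocycleExtension c) where
  mul x y := ⟨x.left + x.right • y.left + c x.right y.right, x.right * y.right⟩

instance : One (CocycleExtension c) where
  one := ⟨-c 1 1, 1⟩

instance : Inv (CocycleExtension c) where
  inv x := ⟨-c 1 1 - x.right⁻¹ • x.left - c x.right⁻¹ x.right, x.right⁻¹⟩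

theorem mul_left (x y : CocycleExtension c) :
    (x * y).left = x.left + x.right • y.left + c x.right y.right := rfl

theorem mul_right (x y : CocycleExtension c) : (x * y).right = x.right * y.right := rfl

/-- The group structure on the extension defined by a `2`-cocycle. -/
abbrev group (hc : ∀ u v w, u • c v w - c (u * v) w + c u (v * w) - c u v = 0) :
    Group (CocycleExtension c) :=
  Group.ofLeftAxioms
    (fun x y z => by
      ext
      · have h := hc x.right y.right z.right
        simp only [mul_left, mul_right, smul_add, mul_smul]
        rw [← sub_eq_zero, ← neg_eq_zero, ← h]
        abel
      · exact mul_assoc _ _ _)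
    (fun x => by
      ext
      · have h := hc 1 1 x.right
        simp only [one_smul, one_mul, sub_self, zero_add, sub_eq_zero] at h
        change -c 1 1 + (1 : G) • x.left + c 1 x.right = x.left
        rw [one_smul, h]
        abel
      · exact one_mul _)
    (fun x => by
      ext
      · change -c 1 1 - x.right⁻¹ • x.left - c x.right⁻¹ x.right + x.right⁻¹ • x.left +
          c x.right⁻¹ x.right = -c 1 1
        abel
      · exact inv_mul_cancel _)

end CocycleExtension

section Retract

variable {Γ : Type w} {G : Type u} [Group Γ] [Group G] [MulDistribMulAction Γ G]
  {X : Type x} [MulAction Γ X]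

theorem exists_equivariant_trivialization {A : Type v} [AddCommGroup A] [DistribMulAction G A]
    [DistribMulAction Γ A] (i : G →* FreeGroup X) (r : FreeGroup X →* G)
    (hi : ∀ (σ : Γ) (g : G), i (σ • g) = σ • i g)
    (hr : ∀ (σ : Γ) (w : FreeGroup X), r (σ • w) = σ • r w)
    (hri : r.comp i = MonoidHom.id G)
    (hcompat : ∀ (σ : Γ) (g : G) (a : A), σ • (g • a) = (σ • g) • (σ • a)) {c : G → G → A}
    (hequiv : ∀ (σ : Γ) (u v : G), c (σ • u) (σ • v) = σ • c u v)
    (hc : ∀ u v w, u • c v w - c (u * v) w + c u (v * w) - c u v = 0) :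
    ∃ b : G → A, (∀ (σ : Γ) (g : G), b (σ • g) = σ • b g) ∧
      ∀ u v, u • b v - b (u * v) + b u = c u v := by
  let := CocycleExtension.group hc
  let s : FreeGroup X →* CocycleExtension c := FreeGroup.lift fun x => ⟨0, r (FreeGroup.of x)⟩
  let p : CocycleExtension c →* G := MonoidHom.mk' CocycleExtension.right fun _ _ => rfl
  let act (σ : Γ) : CocycleExtension c →* CocycleExtension c :=
    MonoidHom.mk' (fun e => ⟨σ • e.left, σ • e.right⟩) fun e e' => by
      ext
      · simp only [CocycleExtension.mul_left, smul_add, hcompat, hequiv]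
      · exact smul_mul' _ _ _
  have hp : p.comp s = r := by
    ext x
    simp [s, p]
  have hact (σ : Γ) : (act σ).comp s = s.comp (MulDistribMulAction.toMonoidHom _ σ) := by
    ext x : 1
    have hx : σ • FreeGroup.of x = FreeGroup.of (σ • x) := FreeGroup.map.of
    simp [s, act, hx, ← hr]
  have hsi (g : G) : (s (i g)).right = g :=
    (DFunLike.congr_fun hp (i g)).trans (DFunLike.congr_fun hri g)
  refine ⟨fun g => -(s (i g)).left, fun σ g => ?_, fun u v => ?_⟩
  · have h := congrArg CocycleExtension.left (DFunLike.congr_fun (hact σ) (i g))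
    have h' : σ • (s (i g)).left = (s (σ • i g)).left := h
    simp only [hi, ← h', smul_neg]
  · simp only [map_mul, CocycleExtension.mul_left, hsi, smul_neg]
    abel

theorem cobound_one_apply {A : Type v} [AddCommGroup A] [DistribMulAction G A]
    (f : (Fin 1 → G) → A) (u v : G) :
    cobound 1 f ![u, v] = u • f ![v] - f ![u * v] + f ![u] := by
  have h0 : contractTuple 0 ![u, v] = ![u * v] := by
    funext j; fin_cases j; rfl
  have h1 : Fin.init ![u, v] = ![u] := by
    funext j; fin_cases j; rfl
  simp [cobound_apply, h0, h1, sub_eq_add_neg]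

theorem cobound_two_apply {A : Type v} [AddCommGroup A] [DistribMulAction G A]
    (f : (Fin 2 → G) → A) (u v w : G) :
    cobound 2 f ![u, v, w] = u • f ![v, w] - f ![u * v, w] + f ![u, v * w] - f ![u, v] := by
  have h0 : contractTuple 0 ![u, v, w] = ![u * v, w] := by
    funext j; fin_cases j <;> rfl
  have h1 : contractTuple 1 ![u, v, w] = ![u, v * w] := by
    funext j; fin_cases j <;> rfl
  have h2 : Fin.init ![u, v, w] = ![u, v] := by
    funext j; fin_cases j <;> rfl
  simp [cobound_apply, h0, h1, h2, Finset.sum_range_succ, sub_eq_add_neg, add_assoc]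

theorem exists_cobound_one_eq {A : Type v} [AddCommGroup A] [DistribMulAction G A]
    [DistribMulAction Γ A] (i : G →* FreeGroup X) (r : FreeGroup X →* G)
    (hi : ∀ (σ : Γ) (g : G), i (σ • g) = σ • i g)
    (hr : ∀ (σ : Γ) (w : FreeGroup X), r (σ • w) = σ • r w)
    (hri : r.comp i = MonoidHom.id G)
    (hcompat : ∀ (σ : Γ) (g : G) (a : A), σ • (g • a) = (σ • g) • (σ • a))
    (f : (Fin 2 → G) → A)
    (hequiv : ∀ (σ : Γ) (g : Fin 2 → G), f (fun j => σ • g j) = σ • f g)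
    (hf : cobound 2 f = 0) :
    ∃ h : (Fin 1 → G) → A,
      (∀ (σ : Γ) (g : Fin 1 → G), h (fun j => σ • g j) = σ • h g) ∧ cobound 1 h = f := by
  obtain ⟨b, hb_equiv, hb⟩ := exists_equivariant_trivialization i r hi hr hri hcompat
    (c := fun u v => f ![u, v])
    (fun σ u v => by
      rw [← hequiv]
      congr 1
      funext j
      fin_cases j <;> rfl)
    (fun u v w => by rw [← cobound_two_apply, hf, Pi.zero_apply])
  refine ⟨fun g => b (g 0), fun σ g => hb_equiv σ (g 0), funext fun g => ?_⟩
  have hg : g = ![g 0, g 1] := by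
    funext j
    fin_cases j <;> rfl
  rw [hg, cobound_one_apply]
  exact hb _ _

theorem exists_cobound_eq_aux (i : G →* FreeGroup X) (r : FreeGroup X →* G)
    (hi : ∀ (σ : Γ) (g : G), i (σ • g) = σ • i g)
    (hr : ∀ (σ : Γ) (w : FreeGroup X), r (σ • w) = σ • r w)
    (hri : r.comp i = MonoidHom.id G) (n : ℕ) :
    ∀ {A : Type (max u v)} [AddCommGroup A] [DistribMulAction G A] [DistribMulAction Γ A],
      (∀ (σ : Γ) (g : G) (a : A), σ • (g • a) = (σ • g) • (σ • a)) →
      ∀ f : (Fin (n + 2) → G) → A,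
        (∀ (σ : Γ) (g : Fin (n + 2) → G), f (fun j => σ • g j) = σ • f g) →
        cobound (n + 2) f = 0 → ∃ h : (Fin (n + 1) → G) → A,
          (∀ (σ : Γ) (g : Fin (n + 1) → G), h (fun j => σ • g j) = σ • h g) ∧
            cobound (n + 1) h = f := by
  induction n with
  | zero =>
    intro A _ _ _ hcompat f
    exact exists_cobound_one_eq i r hi hr hri hcompat f
  | succ n ih =>
    intro A _ _ _ hcompat f
    exact exists_cobound_eq_of_normalizedFun hcompat
      (ih (NormalizedFun.smul_smul_compat hcompat)) f

theorem exists_cobound_eq {A : Type v} [AddCommGroup A] [DistribMulAction G A]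
    [DistribMulAction Γ A] (i : G →* FreeGroup X) (r : FreeGroup X →* G)
    (hi : ∀ (σ : Γ) (g : G), i (σ • g) = σ • i g)
    (hr : ∀ (σ : Γ) (w : FreeGroup X), r (σ • w) = σ • r w)
    (hri : r.comp i = MonoidHom.id G)
    (hcompat : ∀ (σ : Γ) (g : G) (a : A), σ • (g • a) = (σ • g) • (σ • a)) (n : ℕ)
    (f : (Fin (n + 2) → G) → A)
    (hequiv : ∀ (σ : Γ) (g : Fin (n + 2) → G), f (fun j => σ • g j) = σ • f g)
    (hf : cobound (n + 2) f = 0) :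
    ∃ h : (Fin (n + 1) → G) → A,
      (∀ (σ : Γ) (g : Fin (n + 1) → G), h (fun j => σ • g j) = σ • h g) ∧
        cobound (n + 1) h = f := by
  cases n with
  | zero => exact exists_cobound_one_eq i r hi hr hri hcompat f hequiv hf
  | succ n =>
    exact exists_cobound_eq_of_normalizedFun hcompat
      (exists_cobound_eq_aux.{u, v} i r hi hr hri n (NormalizedFun.smul_smul_compat hcompat))
      f hequiv hf

end Retract

/-- Let `G` be a Γ-group which is a retract of a free group on a Γ-set,
and let `A` be a `G⋊Γ`-module.  Then the complex of Γ-equivariant inhomogeneous cochains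
`C^n_Γ(G,A)` with the standard coboundary is exact in every degree `> 1`
(every degree `> 1` is of the form `n + 2`): an equivariant `(n+2)`-cochain is a cocycle
iff it is the coboundary of an equivariant `(n+1)`-cochain. -/
theorem equivariant_cochain_complex_exact (X : Type*) [MulAction Γ X]
    (i : G →* FreeGroup X) (r : FreeGroup X →* G)
    (hi : ∀ (σ : Γ) (g : G), i (σ • g) = σ • i g)
    (hr : ∀ (σ : Γ) (w : FreeGroup X), r (σ • w) = σ • r w)
    (hri : r.comp i = MonoidHom.id G)
    (hcompat : ∀ (σ : Γ) (g : G) (a : A), σ • (g • a) = (σ • g) • (σ • a)) :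
    ∀ (n : ℕ) (f : (Fin (n + 2) → G) → A),
      (∀ (σ : Γ) (g : Fin (n + 2) → G), f (fun j => σ • g j) = σ • f g) →
      (cobound (n + 2) f = 0 ↔
        ∃ h : (Fin (n + 1) → G) → A,
          (∀ (σ : Γ) (g : Fin (n + 1) → G), h (fun j => σ • g j) = σ • h g) ∧
            cobound (n + 1) h = f) := by
  intro n f hequiv
  refine ⟨exists_cobound_eq i r hi hr hri hcompat n f hequiv, ?_⟩
  rintro ⟨h, -, rfl⟩
  exact cobound_cobound_succ n h
end
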